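/- Let Δ be a real-valued random variable such that Δ ≤ b almost surely for some constant b ∈ ℝ, E[Δ] < 0, and P(Δ > 0) > 0. Then there exists θ > 0 such that E[exp(θΔ)] = 1. -/

import Mathlib

open MeasureTheory

/-- If `Δ` is a real random variable that is bounded above by a constant `b`
almost surely, has negative mean `E[Δ] < 0`, and satisfies `P(Δ > 0) > 0`, then there
exists `θ > 0` with `E[exp(θ Δ)] = 1` (existence of the Cramér–Lundberg root). -/
theorem stmt_5
    {Ω : Type*} [MeasurableSpace Ω] (μ : Measure Ω) [IsProbabilityMeasure μ]
    (Δ : Ω → ℝ) (hΔ_meas : Measurable Δ)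
    (b : ℝ) (hb : ∀ᵐ ω ∂μ, Δ ω ≤ b)
    (hmean : ∫ ω, Δ ω ∂μ < 0)
    (hpos : 0 < μ {ω | 0 < Δ ω}) :
    ∃ θ : ℝ, 0 < θ ∧ ∫ ω, Real.exp (θ * Δ ω) ∂μ = 1 := by
  have hint : Integrable Δ μ := by
    by_contra h
    rw [integral_undef h] at hmean
    exact lt_irrefl _ hmean
  have hle : ∀ T θ : ℝ, 0 ≤ θ → θ ≤ T → ∀ᵐ ω ∂μ, Real.exp (θ * Δ ω) ≤ Real.exp (T * |b|) := by
    intro T θ h0 hT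
    filter_upwards [hb] with ω hω
    apply Real.exp_le_exp.2
    calc θ * Δ ω ≤ θ * |b| := mul_le_mul_of_nonneg_left (hω.trans (le_abs_self b)) h0
      _ ≤ T * |b| := mul_le_mul_of_nonneg_right hT (abs_nonneg b)
  have hbd : ∀ T θ : ℝ, 0 ≤ θ → θ ≤ T → ∀ᵐ ω ∂μ, ‖Real.exp (θ * Δ ω)‖ ≤ Real.exp (T * |b|) := by
    intro T θ h0 hT
    filter_upwards [hle T θ h0 hT] with ω hω
    rwa [Real.norm_eq_abs, Real.abs_exp]
  have hm : ∀ θ : ℝ, AEStronglyMeasurable (fun ω => Real.exp (θ * Δ ω)) μ := fun θ =>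
    (by fun_prop : Measurable (fun ω => Real.exp (θ * Δ ω))).aestronglyMeasurable
  have hI : ∀ θ : ℝ, 0 ≤ θ → Integrable (fun ω => Real.exp (θ * Δ ω)) μ := fun θ h =>
    (integrable_const (Real.exp (θ * |b|))).mono' (hm θ) (hbd θ θ h le_rfl)
  -- small parameter
  have h1 : ∃ θ : ℝ, 0 < θ ∧ ∫ ω, Real.exp (θ * Δ ω) ∂μ < 1 := by
    let t : ℕ → ℝ := fun n => 1 / ((n : ℝ) + 1)
    have ht0 : ∀ n, 0 < t n := fun n => Nat.one_div_pos_of_nat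
    have ht1 : ∀ n, t n ≤ 1 := fun n => by
      have : (0 : ℝ) ≤ n := n.cast_nonneg
      simp only [t]
      rw [div_le_one (by positivity)]
      linarith
    have htt : Filter.Tendsto t Filter.atTop (nhdsWithin 0 {0}ᶜ) := by
      refine tendsto_nhdsWithin_iff.2 ⟨tendsto_one_div_add_atTop_nhds_zero_nat, ?_⟩
      exact Filter.Eventually.of_forall fun n => (ht0 n).ne'
    have hlim : Filter.Tendsto (fun n => ∫ ω, (t n)⁻¹ * (Real.exp (t n * Δ ω) - 1) ∂μ)
        Filter.atTop (nhds (∫ ω, Δ ω ∂μ)) := by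
      refine tendsto_integral_of_dominated_convergence
        (fun ω => Real.exp (1 * |b|) * |Δ ω|) ?_ (hint.abs.const_mul _) ?_ ?_
      · intro n
        exact ((hm (t n)).sub aestronglyMeasurable_const).const_mul _
      · intro n
        filter_upwards [hle 1 (t n) (ht0 n).le (ht1 n)] with ω hω
        have hE : 1 ≤ Real.exp (1 * |b|) := Real.one_le_exp (by positivity)
        rw [norm_mul, norm_inv, Real.norm_eq_abs, Real.norm_eq_abs, abs_of_pos (ht0 n),
          inv_mul_le_iff₀ (ht0 n)]
        set x := t n * Δ ω with hx
        have hxa : t n * (Real.exp (1 * |b|) * |Δ ω|) = Real.exp (1 * |b|) * |x| := by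
          rw [hx, abs_mul, abs_of_pos (ht0 n)]; ring
        rw [hxa]
        have e1 := Real.add_one_le_exp x
        have e2 : Real.exp x - 1 ≤ x * Real.exp x := by
          have h := Real.add_one_le_exp (-x)
          have h2 : Real.exp (-x) * Real.exp x = 1 := by rw [← Real.exp_add]; simp
          nlinarith [Real.exp_pos x]
        have e3 : x * Real.exp x ≤ |x| * Real.exp (1 * |b|) :=
          mul_le_mul (le_abs_self x) hω (Real.exp_pos x).le (abs_nonneg x)
        rw [abs_le]
        constructor
        · nlinarith [neg_abs_le x, abs_nonneg x]
        · linarith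
      · refine Filter.Eventually.of_forall fun ω => ?_
        have hd : HasDerivAt (fun s : ℝ => Real.exp (s * Δ ω)) (Δ ω) 0 := by
          have := ((hasDerivAt_id (0 : ℝ)).mul_const (Δ ω)).exp
          simpa using this
        have := (hasDerivAt_iff_tendsto_slope_zero.1 hd).comp htt
        simpa [Function.comp_def] using this
    obtain ⟨n, hn⟩ := (hlim.eventually (gt_mem_nhds hmean)).exists
    refine ⟨t n, ht0 n, ?_⟩
    rw [integral_const_mul, integral_sub (hI _ (ht0 n).le) (integrable_const _)] at hn
    have := (pos_iff_neg_of_mul_neg hn).1 (inv_pos.2 (ht0 n))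
    simp at this
    linarith
  obtain ⟨θ₁, hθ₁, hF1⟩ := h1
  have hpint : Integrable (fun ω => max (Δ ω) 0) μ := hint.pos_part
  have hc : 0 < ∫ ω, max (Δ ω) 0 ∂μ := by
    have hnn : 0 ≤ fun ω => max (Δ ω) 0 := fun ω => le_max_right _ _
    rw [integral_pos_iff_support_of_nonneg hnn hpint]
    refine hpos.trans_le (measure_mono fun ω hω => ?_)
    have h : 0 < Δ ω := hω
    exact (lt_max_of_lt_left h).ne'
  set c := ∫ ω, max (Δ ω) 0 ∂μ with hcdef
  have hθ₂ : θ₁ ≤ θ₁ + 1 / c := by have := one_div_pos.2 hc; linarith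
  have hF2 : 1 ≤ ∫ ω, Real.exp ((θ₁ + 1 / c) * Δ ω) ∂μ := by
    have h0 : 0 ≤ θ₁ + 1 / c := hθ₁.le.trans hθ₂
    calc (1 : ℝ) ≤ (θ₁ + 1 / c) * c := by
          rw [add_mul, one_div_mul_cancel hc.ne']
          nlinarith
      _ = ∫ ω, (θ₁ + 1 / c) * max (Δ ω) 0 ∂μ := by rw [integral_const_mul]
      _ ≤ _ := by
        refine integral_mono (hpint.const_mul _) (hI _ h0) fun ω => ?_
        simp only
        rw [mul_max_of_nonneg _ _ h0, mul_zero]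
        refine max_le ?_ (Real.exp_pos _).le
        linarith [Real.add_one_le_exp ((θ₁ + 1 / c) * Δ ω)]
  have hcont : ContinuousOn (fun θ : ℝ => ∫ ω, Real.exp (θ * Δ ω) ∂μ)
      (Set.Icc θ₁ (θ₁ + 1 / c)) := by
    refine continuousOn_of_dominated (bound := fun _ => Real.exp ((θ₁ + 1 / c) * |b|))
      (fun θ _ => hm θ) (fun θ hθ => hbd _ θ (hθ₁.le.trans hθ.1) hθ.2) (integrable_const _) ?_
    exact Filter.Eventually.of_forall fun ω => by fun_prop
  obtain ⟨θ, hθ, h⟩ := intermediate_value_Icc hθ₂ hcont ⟨hF1.le, hF2⟩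
  exact ⟨θ, hθ₁.trans_le hθ.1, h⟩
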